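/- Let 0 < b < c be fixed. Then the function a ↦ ∫_{b²}^{c²} dt/√((t − a²)·(t − b²)·(c² − t)), defined for 0 < a < b, tends to +∞ as a → b⁻. -/

import Mathlib

open MeasureTheory Set Filter

theorem one_div_sqrt_mul_le {x y : ℝ} (hx : 0 < x) (hy : 0 < y) :
    1 / √(x * y) ≤ (x ^ (-(1 / 2) : ℝ) + y ^ (-(1 / 2) : ℝ)) / √(x + y) := by
  have hsx := Real.sqrt_pos.2 hx
  have hsy := Real.sqrt_pos.2 hy
  have hle : √(x + y) ≤ √x + √y := by
    rw [Real.sqrt_le_left (by positivity)]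
    nlinarith [Real.sq_sqrt hx.le, Real.sq_sqrt hy.le, mul_pos hsx hsy]
  rw [Real.rpow_neg hx.le, Real.rpow_neg hy.le, ← Real.sqrt_eq_rpow, ← Real.sqrt_eq_rpow,
    Real.sqrt_mul hx.le, le_div_iff₀ (Real.sqrt_pos.2 (add_pos hx hy))]
  calc 1 / (√x * √y) * √(x + y) ≤ 1 / (√x * √y) * (√x + √y) := by gcongr
    _ = (√x)⁻¹ + (√y)⁻¹ := by field_simp; ring

theorem integrableOn_one_div_sqrt_cubic {p q r : ℝ} (hpq : p < q) (hqr : q < r) :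
    IntegrableOn (fun t : ℝ => 1 / √((t - p) * (t - q) * (r - t))) (Ioo q r) := by
  have hdom : IntegrableOn (fun t : ℝ =>
      ((t - q) ^ (-(1 / 2) : ℝ) + (r - t) ^ (-(1 / 2) : ℝ)) / √(r - q) / √(q - p)) (Ioo q r) := by
    have h0 (d : ℝ) : IntervalIntegrable (fun t : ℝ => t ^ (-(1 / 2) : ℝ)) volume 0 d :=
      intervalIntegral.intervalIntegrable_rpow' (by norm_num)
    have hl : IntervalIntegrable (fun t : ℝ => (t - q) ^ (-(1 / 2) : ℝ)) volume q r := by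
      simpa using (h0 (r - q)).comp_sub_right q
    have hr : IntervalIntegrable (fun t : ℝ => (r - t) ^ (-(1 / 2) : ℝ)) volume q r := by
      simpa using ((h0 (r - q)).comp_sub_left r).symm
    exact (intervalIntegrable_iff_integrableOn_Ioo_of_le hqr.le).1
      (((hl.add hr).div_const _).div_const _)
  have hmeas : Measurable fun t : ℝ => 1 / √((t - p) * (t - q) * (r - t)) := by fun_prop
  refine hdom.mono' hmeas.aestronglyMeasurable ?_
  filter_upwards [ae_restrict_mem measurableSet_Ioo] with t ht
  have hx : 0 < t - q := sub_pos.2 ht.1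
  have hy : 0 < r - t := sub_pos.2 ht.2
  have hp : 0 < q - p := sub_pos.2 hpq
  have hbound := one_div_sqrt_mul_le hx hy
  rw [show t - q + (r - t) = r - q by ring] at hbound
  rw [Real.norm_of_nonneg (by positivity)]
  calc 1 / √((t - p) * (t - q) * (r - t)) ≤ 1 / √((q - p) * ((t - q) * (r - t))) := by
        rw [mul_assoc]
        gcongr
        exact ht.1.le
    _ = 1 / √((t - q) * (r - t)) / √(q - p) := by
        rw [Real.sqrt_mul hp.le, div_div, mul_comm]
    _ ≤ _ := by gcongr

theorem log_sub_log_div_le_integral_one_div_sqrt_cubic {p q r : ℝ} (hpq : p < q) (hqr : q < r) :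
    (Real.log (r - q) - Real.log (q - p)) / √(r - q) ≤
      ∫ t in Ioo q r, 1 / √((t - p) * (t - q) * (r - t)) := by
  have hp : 0 < q - p := sub_pos.2 hpq
  have hr : 0 < r - q := sub_pos.2 hqr
  have hinv : IntervalIntegrable (fun t : ℝ => (t - p)⁻¹) volume q r := by
    refine ContinuousOn.intervalIntegrable fun t ht => ?_
    rw [uIcc_of_le hqr.le] at ht
    exact ((continuousAt_id.sub continuousAt_const).inv₀
      (sub_pos.2 (hpq.trans_le ht.1)).ne').continuousWithinAt
  have heval : ∫ t in Ioo q r, (t - p)⁻¹ / √(r - q) =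
      (Real.log (r - p) - Real.log (q - p)) / √(r - q) := by
    rw [← integral_Ioc_eq_integral_Ioo, ← intervalIntegral.integral_of_le hqr.le,
      intervalIntegral.integral_div, intervalIntegral.integral_comp_sub_right (fun t => t⁻¹),
      integral_inv_of_pos hp (hp.trans (by linarith)), Real.log_div (by linarith) hp.ne']
  calc (Real.log (r - q) - Real.log (q - p)) / √(r - q)
      ≤ (Real.log (r - p) - Real.log (q - p)) / √(r - q) := by gcongr
    _ = ∫ t in Ioo q r, (t - p)⁻¹ / √(r - q) := heval.symm
    _ ≤ _ := by
      refine setIntegral_mono_on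
        ((intervalIntegrable_iff_integrableOn_Ioo_of_le hqr.le).1 (hinv.div_const _))
        (integrableOn_one_div_sqrt_cubic hpq hqr) measurableSet_Ioo fun t ht => ?_
      have hx : 0 < t - q := sub_pos.2 ht.1
      have hy : 0 < r - t := sub_pos.2 ht.2
      have hz : 0 < t - p := by linarith
      calc (t - p)⁻¹ / √(r - q) = 1 / √((t - p) * (t - p) * (r - q)) := by
            rw [Real.sqrt_mul (by positivity), Real.sqrt_mul_self hz.le, inv_eq_one_div, div_div]
        _ ≤ 1 / √((t - p) * (t - q) * (r - t)) := by
            gcongr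
            exact ht.1.le

/-- As `a → b⁻`, the elliptic integral `∫_{b²}^{c²} dt/√((t − a²)(t − b²)(c² − t))` tends to
`+∞`. -/
theorem elliptic_integral_tendsto_atTop (b c : ℝ) (hb : 0 < b) (hbc : b < c) :
    Tendsto (fun a : ℝ =>
        ∫ t in Ioo (b ^ 2) (c ^ 2),
          1 / Real.sqrt ((t - a ^ 2) * (t - b ^ 2) * (c ^ 2 - t)))
      (nhdsWithin b (Iio b)) atTop := by
  have hcb : b ^ 2 < c ^ 2 := by gcongr
  have hsub : Tendsto (fun a : ℝ => b ^ 2 - a ^ 2) (nhdsWithin b (Iio b))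
      (nhdsWithin 0 (Ioi 0)) := by
    refine tendsto_nhdsWithin_iff.2 ⟨?_, ?_⟩
    · have hcont : Continuous fun a : ℝ => b ^ 2 - a ^ 2 := by fun_prop
      simpa using (hcont.tendsto b).mono_left nhdsWithin_le_nhds
    · filter_upwards [Ioo_mem_nhdsLT hb] with a ha
      exact sub_pos.2 (pow_lt_pow_left₀ ha.2 ha.1.le two_ne_zero)
  have hlog := Real.tendsto_log_nhdsGT_zero.comp hsub
  refine tendsto_atTop_mono' _ ?_ ((tendsto_atTop_add_const_left _ (Real.log (c ^ 2 - b ^ 2))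
    (tendsto_neg_atBot_atTop.comp hlog)).atTop_div_const (Real.sqrt_pos.2 (sub_pos.2 hcb)))
  filter_upwards [Ioo_mem_nhdsLT hb] with a ha
  exact log_sub_log_div_le_integral_one_div_sqrt_cubic
    (pow_lt_pow_left₀ ha.2 ha.1.le two_ne_zero) hcb
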